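/- arXiv:2211.03087 — 3 statements merged into one kernel-verified Lean document; each statement's English description precedes it below -/
import Mathlib

section
/- Let R > 0 and let u : ℤ × ℤ → ℝ satisfy the discrete equation (discr1): for all n, m, exp(-u(n+1,m+1)) = exp(-u(n,m+1))·E(n,m)² + √(2R)·E(n,m), where E(n,m) = exp(u(n,m))·(√(exp(-u(n,m)-u(n+1,m)) + R/2) + √(R/2)). Then the function F̃₁(n,m) = √(R·exp(2u(n+1,m)) + 2·exp(u(n+1,m)-u(n,m))) + √(R·exp(2u(n+1,m)) + 2·exp(u(n+1,m)-u(n+2,m))) satisfies F̃₁(n,m+1) = F̃₁(n,m) for all n, m; that is, F̃₁ is an m-integral of equation (discr1). -/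
/-- The coefficient E(n,m) of the discrete equation (discr1). -/
noncomputable def Ecoef (R : ℝ) (u : ℤ × ℤ → ℝ) (n m : ℤ) : ℝ :=
  Real.exp (u (n, m)) *
    (Real.sqrt (Real.exp (-u (n, m) - u (n + 1, m)) + R / 2) + Real.sqrt (R / 2))

/-- The function F̃₁(n,m) built from u(n,m), u(n+1,m), u(n+2,m). -/
noncomputable def Ftilde (R : ℝ) (u : ℤ × ℤ → ℝ) (n m : ℤ) : ℝ :=
  Real.sqrt (R * Real.exp (2 * u (n + 1, m)) + 2 * Real.exp (u (n + 1, m) - u (n, m))) +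
  Real.sqrt (R * Real.exp (2 * u (n + 1, m)) + 2 * Real.exp (u (n + 1, m) - u (n + 2, m)))

open Real in
lemma sqrt_two_mul_eq (R : ℝ) : √(2 * R) = 2 * √(R / 2) := by
  rw [show 2 * R = 2 ^ 2 * (R / 2) by ring, sqrt_mul (by positivity), sqrt_sq zero_le_two]

open Real in
/-- Factorization of each of the two radicals in `Ftilde`. -/
lemma sqrt_radical_eq (R x y : ℝ) :
    √(R * exp (2 * y) + 2 * exp (y - x)) = √2 * (exp y * √(exp (-x - y) + R / 2)) := by
  have h : R * exp (2 * y) + 2 * exp (y - x) = 2 * (exp y ^ 2 * (exp (-x - y) + R / 2)) := by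
    have h1 : exp (2 * y) = exp y ^ 2 := by rw [sq, ← exp_add]; ring_nf
    have h2 : exp (y - x) = exp y ^ 2 * exp (-x - y) := by
      rw [← h1, ← exp_add]; ring_nf
    rw [h1, h2]; ring
  rw [h, sqrt_mul zero_le_two, sqrt_mul (sq_nonneg _), sqrt_sq (exp_pos y).le]

open Real in
lemma Ecoef_pos {R : ℝ} (hR : 0 < R) (u : ℤ × ℤ → ℝ) (n m : ℤ) : 0 < Ecoef R u n m := by
  unfold Ecoef
  positivity

open Real in
/-- Rationalizing the inverse of `Ecoef`. -/
lemma Ecoef_inv {R : ℝ} (hR : 0 < R) (u : ℤ × ℤ → ℝ) (n m : ℤ) :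
    (Ecoef R u n m)⁻¹ =
      exp (u (n + 1, m)) * (√(exp (-u (n, m) - u (n + 1, m)) + R / 2) - √(R / 2)) := by
  refine inv_eq_of_mul_eq_one_right ?_
  have hW := sq_sqrt (show 0 ≤ exp (-u (n, m) - u (n + 1, m)) + R / 2 by positivity)
  have hs := sq_sqrt (show 0 ≤ R / 2 by positivity)
  have h : exp (u (n, m)) * exp (u (n + 1, m)) * exp (-u (n, m) - u (n + 1, m)) = 1 := by
    rw [← exp_add, ← exp_add, ← exp_zero]; ring_nf
  unfold Ecoef
  linear_combination exp (u (n, m)) * exp (u (n + 1, m)) * (hW - hs) + h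

open Real in
/-- `Ftilde` in terms of `Ecoef` on the same layer. -/
lemma Ftilde_eq {R : ℝ} (hR : 0 < R) (u : ℤ × ℤ → ℝ) (n m : ℤ) :
    Ftilde R u n m = √2 * ((Ecoef R u n m)⁻¹ + Ecoef R u (n + 1) m) := by
  have h : -u (n + 1, m) - u (n + 2, m) = -u (n + 2, m) - u (n + 1, m) := by ring
  rw [Ecoef_inv hR, Ftilde, Ecoef, sqrt_radical_eq, sqrt_radical_eq, add_assoc n 1 1,
    one_add_one_eq_two, h]
  ring

open Real in
/-- On solutions of the discrete equation, the radical on the shifted layer is rational in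
`Ecoef`. -/
lemma sqrt_shift_eq {R x y E : ℝ} (hR : 0 < R) (hE : 0 < E)
    (h : exp (-y) = exp (-x) * E ^ 2 + √(2 * R) * E) :
    √(exp (-x - y) + R / 2) = exp (-x) * E + √(R / 2) := by
  have hs := sq_sqrt (show 0 ≤ R / 2 by positivity)
  rw [sqrt_eq_iff_mul_self_eq_of_pos (by positivity), sub_eq_add_neg, exp_add, h, sqrt_two_mul_eq]
  linear_combination hs

/-- F̃₁ is an m-integral of the discrete equation (discr1). -/
theorem mIntegral_of_discr1 (R : ℝ) (hR : 0 < R) (u : ℤ × ℤ → ℝ)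
    (heq : ∀ n m : ℤ,
      Real.exp (-u (n + 1, m + 1)) =
        Real.exp (-u (n, m + 1)) * (Ecoef R u n m) ^ 2 +
          Real.sqrt (2 * R) * Ecoef R u n m) :
    ∀ n m : ℤ, Ftilde R u n (m + 1) = Ftilde R u n m := by
  intro n m
  have hE := Ecoef_pos hR u n m
  have hG := Ecoef_pos hR u (n + 1) m
  have h₁ := heq n m
  have h₂ := heq (n + 1) m
  have hW₁ := sqrt_shift_eq hR hE h₁
  rw [add_assoc n 1 1, one_add_one_eq_two] at h₂
  have hW₂ := sqrt_shift_eq hR hG h₂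
  have hy : Real.exp (u (n + 1, m + 1)) * Real.exp (-u (n + 1, m + 1)) = 1 := by
    rw [← Real.exp_add, add_neg_cancel, Real.exp_zero]
  have hsum : Real.exp (u (n + 1, m + 1)) *
      (Real.exp (-u (n, m + 1)) * Ecoef R u n m + 2 * Real.sqrt (R / 2)) =
        (Ecoef R u n m)⁻¹ := by
    refine eq_inv_of_mul_eq_one_left ?_
    rw [h₁, sqrt_two_mul_eq] at hy
    linear_combination hy
  have hsymm : -u (n + 2, m + 1) - u (n + 1, m + 1) =
      -u (n + 1, m + 1) - u (n + 2, m + 1) := by ring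
  rw [Ftilde_eq hR u n m, Ftilde, sqrt_radical_eq, sqrt_radical_eq, hsymm, hW₁, hW₂]
  linear_combination Real.sqrt 2 * hsum + Real.sqrt 2 * Ecoef R u (n + 1) m * hy
end

section
/- Let R > 0, and let E, C be real constants. Let I ⊆ ℝ be an open interval on which (e^{−v}·E + C)² > R/2 and e^{−v}·E + C > 0, and define f : I → ℝ implicitly by √(exp(−f(v) − v) + R/2) = e^{−v}·E + C, i.e. f(v) = −v − ln((e^{−v}E + C)² − R/2). Then f is differentiable on I and satisfies the ODE (eqf1): f′(v) = 1 + R·exp(v + f(v)) + T·√(R²·exp(2(v + f(v))) + 2R·exp(v + f(v))) for all v ∈ I, with the constant T = −C·√(2/R). -/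
/-- The derivative of `v ↦ -v - log ((e^{-v} E + C)² - K)`. -/
theorem hasDerivAt_neg_sub_log_sq_sub (E C K v : ℝ)
    (h : (Real.exp (-v) * E + C) ^ 2 - K ≠ 0) :
    HasDerivAt (fun x => -x - Real.log ((Real.exp (-x) * E + C) ^ 2 - K))
      (-1 + 2 * (Real.exp (-v) * E + C) * (Real.exp (-v) * E) /
        ((Real.exp (-v) * E + C) ^ 2 - K)) v := by
  have hs : HasDerivAt (fun x => Real.exp (-x) * E + C) (Real.exp (-v) * -1 * E) v :=
    (((hasDerivAt_neg v).exp).mul_const E).add_const C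
  refine ((hasDerivAt_neg v).sub (((hs.pow 2).sub_const K).log h)).congr_deriv ?_
  simp only [Pi.pow_apply, Nat.cast_ofNat, Nat.add_one_sub_one, pow_one]
  ring

/-- If `s² = D + R / 2`, then `√(2/R) √(R²/D² + 2R/D) = 2s/D`. -/
theorem sqrt_two_div_mul_sqrt {R s D : ℝ} (hR : 0 < R) (hs : 0 ≤ s) (hD : 0 < D)
    (h : s ^ 2 = D + R / 2) :
    Real.sqrt (2 / R) * Real.sqrt (R ^ 2 * D⁻¹ ^ 2 + 2 * R * D⁻¹) = 2 * s / D := by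
  rw [← Real.sqrt_mul (by positivity), ← Real.sqrt_sq (show 0 ≤ 2 * s / D by positivity)]
  congr 1
  rw [div_pow, mul_pow, h]
  field_simp
  ring

/-- The function f(v) = −v − ln((e^{−v}E + C)² − R/2), defined on an open interval
where (e^{−v}E + C)² > R/2 and e^{−v}E + C > 0, solves the ODE (eqf1)
f′ = 1 + R e^{v+f} + T √(R² e^{2(v+f)} + 2R e^{v+f}) with T = −C√(2/R). -/
theorem solves_eqf1 (R E C : ℝ) (hR : 0 < R) (I : Set ℝ) (hI : IsOpen I)
    (hI' : I.OrdConnected)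
    (hpos : ∀ v ∈ I, R / 2 < (Real.exp (-v) * E + C) ^ 2)
    (hpos' : ∀ v ∈ I, 0 < Real.exp (-v) * E + C)
    (f : ℝ → ℝ)
    (hf : ∀ v ∈ I, f v = -v - Real.log ((Real.exp (-v) * E + C) ^ 2 - R / 2)) :
    DifferentiableOn ℝ f I ∧
      ∀ v ∈ I,
        deriv f v =
          1 + R * Real.exp (v + f v) +
            (-C * Real.sqrt (2 / R)) *
              Real.sqrt (R ^ 2 * Real.exp (2 * (v + f v)) + 2 * R * Real.exp (v + f v)) := by
  have key : ∀ v ∈ I, HasDerivAt f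
      (-1 + 2 * (Real.exp (-v) * E + C) * (Real.exp (-v) * E) /
        ((Real.exp (-v) * E + C) ^ 2 - R / 2)) v := fun v hv =>
    (hasDerivAt_neg_sub_log_sq_sub E C (R / 2) v (sub_pos.2 (hpos v hv)).ne').congr_of_eventuallyEq
      (Filter.eventuallyEq_of_mem (hI.mem_nhds hv) hf)
  refine ⟨fun v hv => (key v hv).differentiableAt.differentiableWithinAt, fun v hv => ?_⟩
  have hD := sub_pos.2 (hpos v hv)
  have hs := hpos' v hv
  have hexp : Real.exp (v + f v) = ((Real.exp (-v) * E + C) ^ 2 - R / 2)⁻¹ := by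
    rw [hf v hv, ← Real.exp_log hD, ← Real.exp_neg, Real.exp_log hD]
    congr 1
    ring
  have hexp2 : Real.exp (2 * (v + f v)) = Real.exp (v + f v) ^ 2 := by
    rw [← Real.exp_nat_mul, Nat.cast_ofNat]
  rw [(key v hv).deriv, hexp2, hexp, mul_assoc (-C),
    sqrt_two_div_mul_sqrt hR hs.le hD (by ring)]
  generalize hDs : (Real.exp (-v) * E + C) ^ 2 - R / 2 = D at hD ⊢
  field_simp
  linear_combination 2 * hDs
end

section
/- Let R > 0 and let E : ℝ² → ℝ be positive and differentiable in its second argument. For reals u, u₁, u₂, v define u₁̄ = −ln(e^{−v}·E(u,u₁)² + √(2R)·E(u,u₁)) and u₂̄ = −ln(e^{−u₁̄}·E(u₁,u₂)² + √(2R)·E(u₁,u₂)). Suppose that for all u, u₁, u₂, v ∈ ℝ the identity e^{u₁̄}·√(e^{−u₁̄−v} + R/2) + e^{u₁̄}·√(e^{−u₁̄−u₂̄} + R/2) = e^{u₁}·√(e^{−u₁−u} + R/2) + e^{u₁}·√(e^{−u₁−u₂} + R/2) holds. Then there exists a function M : ℝ → ℝ such that E(a,b) = e^{a}·√(e^{−a−b}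 + R/2) + M(a) for all a, b ∈ ℝ. -/
/-- u₁̄ as a function of u, u₁ and v = u_{\bar 1}, for a coefficient function E. -/
noncomputable def u1barE (R : ℝ) (E : ℝ → ℝ → ℝ) (u u₁ v : ℝ) : ℝ :=
  -Real.log (Real.exp (-v) * (E u u₁) ^ 2 + Real.sqrt (2 * R) * E u u₁)

/-- u₂̄ as a function of u, u₁, u₂ and v = u_{\bar 1}, for a coefficient function E. -/
noncomputable def u2barE (R : ℝ) (E : ℝ → ℝ → ℝ) (u u₁ u₂ v : ℝ) : ℝ :=
  -Real.log (Real.exp (-(u1barE R E u u₁ v)) * (E u₁ u₂) ^ 2 +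
    Real.sqrt (2 * R) * E u₁ u₂)

/-- With `X = e^{-x} > 0` and `F > 0`, the radicand
`X (X F² + √(2R) F) + R / 2` is the square of `X F + √(2R) / 2`. -/
theorem exp_mul_sqrt_eq_add {R x F : ℝ} (hR : 0 < R) (hF : 0 < F) :
    Real.exp x * Real.sqrt (Real.exp (-x -
      -Real.log (Real.exp (-x) * F ^ 2 + Real.sqrt (2 * R) * F)) + R / 2) =
      F + Real.exp x * (Real.sqrt (2 * R) / 2) := by
  have hs : Real.sqrt (2 * R) ^ 2 = 2 * R := Real.sq_sqrt (by positivity)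
  have hX : Real.exp x * Real.exp (-x) = 1 := by rw [← Real.exp_add]; simp
  have hpos : 0 < Real.exp (-x) * F ^ 2 + Real.sqrt (2 * R) * F := by positivity
  rw [sub_neg_eq_add, Real.exp_add, Real.exp_log hpos,
    show Real.exp (-x) * (Real.exp (-x) * F ^ 2 + Real.sqrt (2 * R) * F) + R / 2 =
      (Real.exp (-x) * F + Real.sqrt (2 * R) / 2) ^ 2 by linear_combination (-1 / 4) * hs,
    Real.sqrt_sq (by positivity)]
  linear_combination F * hX

/-- If the m-integral identity holds for all u, u₁, u₂, v, then the coefficient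
function E has the form E(a,b) = e^a √(e^{−a−b} + R/2) + M(a). -/
theorem E_determined (R : ℝ) (hR : 0 < R) (E : ℝ → ℝ → ℝ)
    (hEpos : ∀ a b : ℝ, 0 < E a b)
    (hEdiff : ∀ a : ℝ, Differentiable ℝ (E a))
    (h : ∀ u u₁ u₂ v : ℝ,
      Real.exp (u1barE R E u u₁ v) *
          Real.sqrt (Real.exp (-(u1barE R E u u₁ v) - v) + R / 2) +
        Real.exp (u1barE R E u u₁ v) *
          Real.sqrt (Real.exp (-(u1barE R E u u₁ v) - u2barE R E u u₁ u₂ v) + R / 2) =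
      Real.exp u₁ * Real.sqrt (Real.exp (-u₁ - u) + R / 2) +
        Real.exp u₁ * Real.sqrt (Real.exp (-u₁ - u₂) + R / 2)) :
    ∃ M : ℝ → ℝ, ∀ a b : ℝ,
      E a b = Real.exp a * Real.sqrt (Real.exp (-a - b) + R / 2) + M a := by
  refine ⟨fun a => E a 0 - Real.exp a * Real.sqrt (Real.exp (-a - 0) + R / 2), fun a b => ?_⟩
  have hb := h 0 a b 0
  have h0 := h 0 a 0 0
  unfold u2barE at hb h0
  rw [exp_mul_sqrt_eq_add hR (hEpos a _)] at hb h0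
  linarith
end
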